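/- For every α ∈ (0,∞) and every t ∈ (0, t_α): (i) (d/dt) ∫ p(x,t)^{α-2} p_1(x,t)² dx = ((α-2)(α-3)/6) · ∫ p^{α-4} p_1⁴ dx − ∫ p^{α-2} p_2² dx; and (ii) (d/dt) ∫ p(x,t)^α dx = −(α(α-1)/2) · ∫ p^{α-2} p_1² dx. -/

import Mathlib

open MeasureTheory Real Filter
open scoped Classical

/-- The density `p(x,t)` of `X + √t Z` along the heat flow. -/
noncomputable def heatP (f : ℝ → ℝ) (t x : ℝ) : ℝ :=
  ∫ y : ℝ, f y * ((Real.sqrt (2 * Real.pi * t))⁻¹ * Real.exp (-(x - y) ^ 2 / (2 * t)))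

/-- `p_k(x,t) = ∂^k p / ∂x^k`. -/
noncomputable def pk (f : ℝ → ℝ) (k : ℕ) (t x : ℝ) : ℝ :=
  iteratedDeriv k (heatP f t) x

/-- `p̄_i = p_i / p`. -/
noncomputable def pbar (f : ℝ → ℝ) (i : ℕ) (t x : ℝ) : ℝ :=
  pk f i t x / heatP f t x

/-- The Rényi entropy `h_α(p(·,t))`, with the Shannon entropy at `α = 1`. -/
noncomputable def renyiEnt (f : ℝ → ℝ) (α t : ℝ) : ℝ :=
  if α = 1 then -∫ x : ℝ, heatP f t x * Real.log (heatP f t x)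
  else (1 - α)⁻¹ * Real.log (∫ x : ℝ, heatP f t x ^ α)

/-- Finiteness `|h_α(p(·,t))| < ∞` of the Rényi entropy at time `t`. -/
def renyiFinite (f : ℝ → ℝ) (α t : ℝ) : Prop :=
  if α = 1 then Integrable (fun x : ℝ => heatP f t x * Real.log (heatP f t x))
  else Integrable (fun x : ℝ => heatP f t x ^ α) ∧ 0 < ∫ x : ℝ, heatP f t x ^ α

/-- `t < t_α` where `t_α = sup { s > 0 : |h_α(p(·,s))| < ∞ }`. -/
def ltTalpha (f : ℝ → ℝ) (α t : ℝ) : Prop :=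
  ∃ s : ℝ, t < s ∧ 0 < s ∧ renyiFinite f α s

/-- The tilted expectation `E_α[g] = (∫ g p^α) / (∫ p^α)`. -/
noncomputable def Ea (f : ℝ → ℝ) (α t : ℝ) (g : ℝ → ℝ) : ℝ :=
  (∫ x : ℝ, g x * heatP f t x ^ α) / (∫ x : ℝ, heatP f t x ^ α)


noncomputable def qn (f : ℝ → ℝ) (n : ℕ) (t x : ℝ) : ℝ :=
  ∫ y : ℝ, f y * ((x - y) ^ n * Real.exp (-(x - y) ^ 2 / (2 * t)))

noncomputable def cc (t : ℝ) : ℝ := (Real.sqrt (2 * Real.pi * t))⁻¹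

noncomputable def PP (f : ℝ → ℝ) : ℕ → ℝ → ℝ → ℝ
  | 0 => fun t x => cc t * qn f 0 t x
  | 1 => fun t x => cc t * (-qn f 1 t x / t)
  | 2 => fun t x => cc t * (-qn f 0 t x / t + qn f 2 t x / t ^ 2)
  | _ => fun t x => cc t * (3 * qn f 1 t x / t ^ 2 - qn f 3 t x / t ^ 3)

lemma gauss_bound (n : ℕ) (b s : ℝ) (hb : 0 < b) (hbs : b < s) :
    ∃ C : ℝ, 0 < C ∧ ∀ u : ℝ, |u| ^ n * Real.exp (-u ^ 2 / (2 * b)) ≤ C * Real.exp (-u ^ 2 / (2 * s)) := by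
  have hs : 0 < s := hb.trans hbs
  set δ : ℝ := 1 / (2 * b) - 1 / (2 * s) with hδ
  have hδ0 : 0 < δ := by
    rw [hδ, sub_pos]
    exact one_div_lt_one_div_of_lt (by positivity) (by linarith)
  refine ⟨1 + (n.factorial : ℝ) / δ ^ n, by positivity, fun u => ?_⟩
  have h1 : (δ * u ^ 2) ^ n / (n.factorial : ℝ) ≤ Real.exp (δ * u ^ 2) :=
    Real.pow_div_factorial_le_exp _ (by positivity) n
  have h2 : |u| ^ n ≤ 1 + (u ^ 2) ^ n := by
    have : (u ^ 2) ^ n = (|u| ^ n) ^ 2 := by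
      rw [← sq_abs u, ← pow_mul, ← pow_mul, mul_comm]
    rw [this]
    nlinarith [sq_nonneg (|u| ^ n - 1)]
  have h3 : (u ^ 2) ^ n ≤ (n.factorial : ℝ) / δ ^ n * Real.exp (δ * u ^ 2) := by
    rw [mul_pow, div_le_iff₀ (by positivity)] at h1
    rw [div_mul_eq_mul_div, le_div_iff₀ (by positivity)]
    linarith
  have h4 : 1 ≤ Real.exp (δ * u ^ 2) := Real.one_le_exp (by positivity)
  have h5 : Real.exp (-u ^ 2 / (2 * s)) = Real.exp (δ * u ^ 2) * Real.exp (-u ^ 2 / (2 * b)) := by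
    rw [← Real.exp_add]; congr 1; rw [hδ]; field_simp; ring
  rw [h5, ← mul_assoc]
  gcongr
  linarith

lemma gauss_bound' (n : ℕ) (t : ℝ) (ht : 0 < t) :
    ∃ C : ℝ, 0 < C ∧ ∀ u : ℝ, |u| ^ n * Real.exp (-u ^ 2 / (2 * t)) ≤ C := by
  obtain ⟨C, hC, h⟩ := gauss_bound n t (2 * t) ht (by linarith)
  refine ⟨C, hC, fun u => (h u).trans ?_⟩
  have : Real.exp (-u ^ 2 / (2 * (2 * t))) ≤ 1 := by
    rw [Real.exp_le_one_iff]
    exact div_nonpos_of_nonpos_of_nonneg (by nlinarith [sq_nonneg u]) (by positivity)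
  nlinarith

lemma exp_mono_t (u : ℝ) {a b : ℝ} (ha : 0 < a) (hab : a ≤ b) :
    Real.exp (-u ^ 2 / (2 * a)) ≤ Real.exp (-u ^ 2 / (2 * b)) := by
  have hb : 0 < b := ha.trans_le hab
  rw [Real.exp_le_exp, div_le_div_iff₀ (by positivity) (by positivity)]
  nlinarith [sq_nonneg u]

lemma qn_int (f : ℝ → ℝ) (hf : Integrable f) (n : ℕ) (t x : ℝ) (ht : 0 < t) :
    Integrable (fun y : ℝ => f y * ((x - y) ^ n * Real.exp (-(x - y) ^ 2 / (2 * t)))) := by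
  obtain ⟨C, hC, h⟩ := gauss_bound' n t ht
  refine hf.mul_bdd (c := C) (Continuous.aestronglyMeasurable (by fun_prop)) ?_
  refine Eventually.of_forall fun y => ?_
  rw [norm_mul, norm_pow, Real.norm_eq_abs, Real.norm_eq_abs, Real.abs_exp]
  exact h _

lemma qn_int_abs (f : ℝ → ℝ) (hf : Integrable f) (n : ℕ) (t x : ℝ) (ht : 0 < t) :
    Integrable (fun y : ℝ => f y * (|x - y| ^ n * Real.exp (-(x - y) ^ 2 / (2 * t)))) := by
  obtain ⟨C, hC, h⟩ := gauss_bound' n t ht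
  refine hf.mul_bdd (c := C) (Continuous.aestronglyMeasurable (by fun_prop)) ?_
  refine Eventually.of_forall fun y => ?_
  rw [norm_mul, norm_pow, Real.norm_eq_abs, Real.norm_eq_abs, Real.abs_exp, abs_abs]
  exact h _

lemma qn_dx (f : ℝ → ℝ) (hf : Integrable f) (n : ℕ) (t x : ℝ) (ht : 0 < t) :
    HasDerivAt (fun x => qn f n t x) (n * qn f (n - 1) t x - qn f (n + 1) t x / t) x := by
  obtain ⟨C1, hC1, h1⟩ := gauss_bound' (n - 1) t ht
  obtain ⟨C2, hC2, h2⟩ := gauss_bound' (n + 1) t ht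
  have key := hasDerivAt_integral_of_dominated_loc_of_deriv_le (μ := volume) (x₀ := x)
    (s := Set.univ)
    (F := fun x y => f y * ((x - y) ^ n * Real.exp (-(x - y) ^ 2 / (2 * t))))
    (F' := fun x y => n * (f y * ((x - y) ^ (n - 1) * Real.exp (-(x - y) ^ 2 / (2 * t))))
      - (f y * ((x - y) ^ (n + 1) * Real.exp (-(x - y) ^ 2 / (2 * t)))) / t)
    (bound := fun y => ‖f y‖ * (n * C1 + C2 / t))
    Filter.univ_mem
    (Eventually.of_forall fun x => (qn_int f hf n t x ht).aestronglyMeasurable)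
    (qn_int f hf n t x ht)
    ((((qn_int f hf (n-1) t x ht).const_mul _).sub
      ((qn_int f hf (n+1) t x ht).div_const _)).aestronglyMeasurable)
    (Eventually.of_forall fun y x _ => ?_)
    (hf.norm.mul_const _)
    (Eventually.of_forall fun y x _ => ?_)
  · have := key.2
    rw [integral_sub ((qn_int f hf (n-1) t x ht).const_mul _) ((qn_int f hf (n+1) t x ht).div_const _),
      integral_const_mul, integral_div] at this
    exact this
  · have e : (n : ℝ) * (f y * ((x - y) ^ (n - 1) * Real.exp (-(x - y) ^ 2 / (2 * t))))
      - (f y * ((x - y) ^ (n + 1) * Real.exp (-(x - y) ^ 2 / (2 * t)))) / t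
      = f y * (n * ((x - y) ^ (n - 1) * Real.exp (-(x - y) ^ 2 / (2 * t)))
      - (((x - y) ^ (n + 1) * Real.exp (-(x - y) ^ 2 / (2 * t)))) / t) := by ring
    rw [e, norm_mul]
    gcongr
    refine (norm_sub_le _ _).trans ?_
    rw [norm_mul, norm_div, norm_mul, norm_mul, norm_pow, norm_pow]
    simp only [Real.norm_eq_abs, Real.abs_exp, Nat.abs_cast, abs_of_pos ht]
    gcongr
    · exact h1 _
    · exact h2 _
  · have d1 : HasDerivAt (fun x : ℝ => x - y) 1 x := (hasDerivAt_id x).sub_const y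
    have d2 := ((d1.fun_pow n).fun_mul ((((d1.fun_pow 2).fun_neg).div_const (2 * t)).exp)).const_mul (f y)
    refine d2.congr_deriv ?_
    field_simp
    ring

lemma qn_dt (f : ℝ → ℝ) (hf : Integrable f) (n : ℕ) (t x : ℝ) (ht : 0 < t) :
    HasDerivAt (fun t => qn f n t x) (qn f (n + 2) t x / (2 * t ^ 2)) t := by
  obtain ⟨C, hC, h⟩ := gauss_bound' (n + 2) (2 * t) (by linarith)
  have key := hasDerivAt_integral_of_dominated_loc_of_deriv_le (μ := volume) (x₀ := t)
    (s := Set.Ioo (t / 2) (2 * t))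
    (F := fun t y => f y * ((x - y) ^ n * Real.exp (-(x - y) ^ 2 / (2 * t))))
    (F' := fun t y => (f y * ((x - y) ^ (n + 2) * Real.exp (-(x - y) ^ 2 / (2 * t)))) / (2 * t ^ 2))
    (bound := fun y => ‖f y‖ * C / (2 * (t / 2) ^ 2))
    (Ioo_mem_nhds (by linarith) (by linarith))
    (by
      filter_upwards [Ioi_mem_nhds ht] with τ hτ
      exact (qn_int f hf n τ x hτ).aestronglyMeasurable)
    (qn_int f hf n t x ht)
    ((qn_int f hf (n+2) t x ht).div_const _).aestronglyMeasurable
    (Eventually.of_forall fun y τ hτ => ?_)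
    ((hf.norm.mul_const _).div_const _)
    (Eventually.of_forall fun y τ hτ => ?_)
  · have := key.2
    rw [integral_div] at this
    exact this
  · have hτ0 : 0 < τ := by linarith [hτ.1]
    rw [norm_div, norm_mul, norm_mul, norm_pow]
    simp only [Real.norm_eq_abs, Real.abs_exp]
    rw [abs_of_pos (show 0 < 2 * τ ^ 2 by positivity)]
    have h1 := hτ.1
    gcongr
    refine le_trans ?_ (h (x - y))
    exact mul_le_mul_of_nonneg_left (exp_mono_t _ hτ0 hτ.2.le) (by positivity)
  · have hτ0 : 0 < τ := by linarith [hτ.1]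
    have d2 := (((((hasDerivAt_id τ).const_mul 2).fun_inv (by simpa using hτ0.ne')).const_mul
      (-(x - y) ^ 2)).exp.const_mul ((x - y) ^ n)).const_mul (f y)
    simp only [id, ← div_eq_mul_inv] at d2
    refine d2.congr_deriv ?_
    field_simp
    ring

lemma cc_pos {t : ℝ} (ht : 0 < t) : 0 < cc t := by
  unfold cc
  have := Real.pi_pos
  positivity

lemma cc_dt (t : ℝ) (ht : 0 < t) : HasDerivAt cc (-cc t / (2 * t)) t := by
  have hp := Real.pi_pos
  have h0 : (2 * Real.pi * t) ≠ 0 := by positivity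
  have hs : 0 < Real.sqrt (2 * Real.pi * t) := Real.sqrt_pos.2 (by positivity)
  have d := (((hasDerivAt_id t).const_mul (2 * Real.pi)).sqrt h0).fun_inv hs.ne'
  refine d.congr_deriv ?_
  unfold cc
  simp only [id]
  have := Real.sq_sqrt (show 0 ≤ 2 * Real.pi * t by positivity)
  rw [this]
  field_simp

lemma PP_dx (f : ℝ → ℝ) (hf : Integrable f) (k : ℕ) (hk : k ≤ 2) (t x : ℝ) (ht : 0 < t) :
    HasDerivAt (fun x => PP f k t x) (PP f (k + 1) t x) x := by
  have d0 := qn_dx f hf 0 t x ht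
  have d1 := qn_dx f hf 1 t x ht
  have d2 := qn_dx f hf 2 t x ht
  interval_cases k
  · refine (d0.const_mul (cc t)).congr_deriv ?_
    simp [PP]; ring
  · refine ((d1.fun_neg.div_const t).const_mul (cc t)).congr_deriv ?_
    norm_num [PP, -mul_eq_mul_left_iff]; field_simp; ring
  · refine (((d0.fun_neg.div_const t).fun_add (d2.div_const (t ^ 2))).const_mul (cc t)).congr_deriv ?_
    norm_num [PP, -mul_eq_mul_left_iff]; field_simp; ring

lemma PP_dt (f : ℝ → ℝ) (hf : Integrable f) (k : ℕ) (hk : k ≤ 1) (t x : ℝ) (ht : 0 < t) :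
    HasDerivAt (fun t => PP f k t x) (PP f (k + 2) t x / 2) t := by
  have d0 := qn_dt f hf 0 t x ht
  have d1 := qn_dt f hf 1 t x ht
  have dc := cc_dt t ht
  interval_cases k
  · refine (dc.fun_mul d0).congr_deriv ?_
    simp [PP]; field_simp
  · refine (dc.fun_mul ((d1.fun_neg).fun_div (hasDerivAt_id t) ht.ne')).congr_deriv ?_
    simp [PP]; field_simp; ring

lemma heatP_eq (f : ℝ → ℝ) (t x : ℝ) : heatP f t x = PP f 0 t x := by
  simp only [heatP, PP, qn, cc]
  rw [← integral_const_mul]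
  congr 1; ext y; simp; ring

lemma pk1_eq (f : ℝ → ℝ) (hf : Integrable f) (t x : ℝ) (ht : 0 < t) : pk f 1 t x = PP f 1 t x := by
  have : heatP f t = fun x => PP f 0 t x := funext (heatP_eq f t)
  rw [pk, iteratedDeriv_one, this]
  exact (PP_dx f hf 0 (by norm_num) t x ht).deriv

lemma pk2_eq (f : ℝ → ℝ) (hf : Integrable f) (t x : ℝ) (ht : 0 < t) : pk f 2 t x = PP f 2 t x := by
  have : deriv (heatP f t) = fun x => PP f 1 t x := by
    ext x
    rw [← pk1_eq f hf t x ht, pk, iteratedDeriv_one]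
  rw [pk, iteratedDeriv_succ, iteratedDeriv_one, this]
  exact (PP_dx f hf 1 (by norm_num) t x ht).deriv

lemma q0_pos (f : ℝ → ℝ) (hf : Integrable f) (hf0 : ∀ x, 0 ≤ f x) (hf1 : (∫ x : ℝ, f x) = 1)
    (t x : ℝ) (ht : 0 < t) : 0 < qn f 0 t x := by
  have h1 : 0 < ∫ x : ℝ, f x := by rw [hf1]; norm_num
  rw [integral_pos_iff_support_of_nonneg hf0 hf] at h1
  unfold qn
  rw [integral_pos_iff_support_of_nonneg _ (qn_int f hf 0 t x ht)]
  · convert h1 using 2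
    ext y
    simp [Real.exp_ne_zero]
  · intro y
    have := hf0 y
    simp only [Pi.zero_apply, pow_zero, one_mul]
    positivity

lemma P0_pos (f : ℝ → ℝ) (hf : Integrable f) (hf0 : ∀ x, 0 ≤ f x) (hf1 : (∫ x : ℝ, f x) = 1)
    (t x : ℝ) (ht : 0 < t) : 0 < PP f 0 t x :=
  mul_pos (cc_pos ht) (q0_pos f hf hf0 hf1 t x ht)

lemma q0_mono (f : ℝ → ℝ) (hf : Integrable f) (hf0 : ∀ x, 0 ≤ f x)
    (t s x : ℝ) (ht : 0 < t) (hts : t ≤ s) : qn f 0 t x ≤ qn f 0 s x := by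
  refine integral_mono (qn_int f hf 0 t x ht) (qn_int f hf 0 s x (by linarith)) fun y => ?_
  have := hf0 y
  simp only [pow_zero, one_mul]
  exact mul_le_mul_of_nonneg_left (exp_mono_t _ ht hts) this

lemma qn_bound (f : ℝ → ℝ) (hf : Integrable f) (hf0 : ∀ x, 0 ≤ f x) (hf1 : (∫ x : ℝ, f x) = 1)
    (α : ℝ) (hα : 0 < α) (b s : ℝ) (hb : 0 < b) (hbs : b < s) (n : ℕ) :
    ∃ K : ℝ, 1 ≤ K ∧ ∀ t x, 0 < t → t ≤ b →
      |qn f n t x| ≤ K * (qn f 0 s x / qn f 0 t x) ^ (α / 4) * qn f 0 t x := by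
  obtain ⟨m, hm⟩ := exists_nat_ge (max 1 (4 / α))
  have hm1 : 1 ≤ m := by exact_mod_cast (le_max_left _ _).trans hm
  have hm2 : 1 ≤ α / 4 * m := by
    have := (le_max_right _ _).trans hm
    rw [div_le_iff₀ hα] at this
    linarith
  obtain ⟨C, hC, hCb⟩ := gauss_bound (n * m) b s hb hbs
  refine ⟨1 + C, by linarith, fun t x ht htb => ?_⟩
  have hq0 := q0_pos f hf hf0 hf1 t x ht
  have hr1 : 1 ≤ qn f 0 s x / qn f 0 t x := by
    rw [le_div_iff₀ hq0, one_mul]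
    exact q0_mono f hf hf0 t s x ht (by linarith)
  set r := qn f 0 s x / qn f 0 t x with hr
  have hr0 : 0 < r := by linarith
  set L := r ^ (α / 4) with hL
  have hL0 : 0 < L := Real.rpow_pos_of_pos hr0 _
  have hLm : r ≤ L ^ m := by
    rw [hL, ← Real.rpow_natCast, ← Real.rpow_mul hr0.le]
    calc r = r ^ (1 : ℝ) := (Real.rpow_one r).symm
      _ ≤ _ := Real.rpow_le_rpow_of_exponent_le hr1 hm2
  have hs : 0 < s := hb.trans hbs
  have pt : ∀ v : ℝ, 0 ≤ v → v ≤ L + L / r * v ^ m := by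
    intro v hv
    by_cases hvL : v ≤ L
    · have : 0 ≤ L / r * v ^ m := by positivity
      linarith
    · push Not at hvL
      have h1 : v / L ≤ (v / L) ^ m := le_self_pow₀ ((one_le_div hL0).2 hvL.le) (by omega)
      have h2 : (v / L) ^ m ≤ v ^ m / r := by
        rw [div_pow]; gcongr
      have h3 : v / L ≤ v ^ m / r := h1.trans h2
      rw [div_le_iff₀ hL0] at h3
      have h4 : v ^ m / r * L = L / r * v ^ m := by ring
      linarith
  have hQ : qn f 0 s x = r * qn f 0 t x := by rw [hr]; field_simp
  calc |qn f n t x| ≤ ∫ y : ℝ, f y * (|x - y| ^ n * Real.exp (-(x - y) ^ 2 / (2 * t))) := by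
        unfold qn
        rw [← Real.norm_eq_abs]
        refine (norm_integral_le_integral_norm _).trans (le_of_eq ?_)
        congr 1; ext y
        rw [norm_mul, norm_mul, norm_pow]
        simp only [Real.norm_eq_abs, Real.abs_exp, abs_of_nonneg (hf0 y)]
    _ ≤ ∫ y : ℝ, (L * (f y * ((x - y) ^ 0 * Real.exp (-(x - y) ^ 2 / (2 * t)))) +
          L / r * C * (f y * ((x - y) ^ 0 * Real.exp (-(x - y) ^ 2 / (2 * s))))) := by
        refine integral_mono (qn_int_abs f hf n t x ht)
          (((qn_int f hf 0 t x ht).const_mul _).add ((qn_int f hf 0 s x hs).const_mul _)) fun y => ?_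
        have hy := hf0 y
        have e1 := pt (|x - y| ^ n) (by positivity)
        rw [← pow_mul] at e1
        have e2 := hCb (x - y)
        have e3 := exp_mono_t (x - y) ht htb
        simp only [pow_zero, one_mul]
        calc f y * (|x - y| ^ n * Real.exp (-(x - y) ^ 2 / (2 * t)))
            ≤ f y * ((L + L / r * |x - y| ^ (n * m)) * Real.exp (-(x - y) ^ 2 / (2 * t))) := by gcongr
          _ = f y * (L * Real.exp (-(x - y) ^ 2 / (2 * t)) + L / r * (|x - y| ^ (n * m) * Real.exp (-(x - y) ^ 2 / (2 * t)))) := by ring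
          _ ≤ f y * (L * Real.exp (-(x - y) ^ 2 / (2 * t)) + L / r * (C * Real.exp (-(x - y) ^ 2 / (2 * s)))) := by
            refine mul_le_mul_of_nonneg_left (add_le_add le_rfl (mul_le_mul_of_nonneg_left ?_ (by positivity))) hy
            refine le_trans ?_ e2
            exact mul_le_mul_of_nonneg_left e3 (by positivity)
          _ = _ := by ring
    _ = L * qn f 0 t x + L / r * C * qn f 0 s x := by
        rw [integral_add ((qn_int f hf 0 t x ht).const_mul _) ((qn_int f hf 0 s x hs).const_mul _),
          integral_const_mul, integral_const_mul]
        rfl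
    _ = (1 + C) * L * qn f 0 t x := by
        rw [hQ]; field_simp

lemma cc_anti {a t : ℝ} (ha : 0 < a) (hat : a ≤ t) : cc t ≤ cc a := by
  unfold cc
  have := Real.pi_pos
  gcongr

lemma PP_bound (f : ℝ → ℝ) (hf : Integrable f) (hf0 : ∀ x, 0 ≤ f x) (hf1 : (∫ x : ℝ, f x) = 1)
    (α : ℝ) (hα : 0 < α) (a b s : ℝ) (ha : 0 < a) (hb : 0 < b) (hbs : b < s) (k : ℕ) :
    ∃ K : ℝ, 1 ≤ K ∧ ∀ t x, a ≤ t → t ≤ b →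
      |PP f k t x| ≤ K * (qn f 0 s x / qn f 0 t x) ^ (α / 4) * PP f 0 t x := by
  obtain ⟨K0, hK0, h0⟩ := qn_bound f hf hf0 hf1 α hα b s hb hbs 0
  obtain ⟨K1, hK1, h1⟩ := qn_bound f hf hf0 hf1 α hα b s hb hbs 1
  obtain ⟨K2, hK2, h2⟩ := qn_bound f hf hf0 hf1 α hα b s hb hbs 2
  obtain ⟨K3, hK3, h3⟩ := qn_bound f hf hf0 hf1 α hα b s hb hbs 3
  have P0 : ∀ t x, PP f 0 t x = cc t * qn f 0 t x := fun t x => rfl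
  -- reduce to a bound on the bracket
  have red : ∀ (g : ℝ → ℝ → ℝ) (K : ℝ), (∀ t x, a ≤ t → t ≤ b →
      |g t x| ≤ K * (qn f 0 s x / qn f 0 t x) ^ (α / 4) * qn f 0 t x) →
      ∃ K : ℝ, 1 ≤ K ∧ ∀ t x, a ≤ t → t ≤ b →
      |cc t * g t x| ≤ K * (qn f 0 s x / qn f 0 t x) ^ (α / 4) * PP f 0 t x := by
    intro g K hg
    refine ⟨max 1 K, le_max_left _ _, fun t x hat htb => ?_⟩
    have ht : 0 < t := by linarith
    have hc := cc_pos ht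
    have hq := q0_pos f hf hf0 hf1 t x ht
    have hq' := q0_pos f hf hf0 hf1 s x (by linarith)
    rw [abs_mul, abs_of_pos hc, P0]
    calc cc t * |g t x| ≤ cc t * (max 1 K * (qn f 0 s x / qn f 0 t x) ^ (α / 4) * qn f 0 t x) := by
          gcongr
          refine (hg t x hat htb).trans ?_
          gcongr
          exact le_max_right _ _
      _ = _ := by ring
  have dv : ∀ (j : ℕ) (t A B : ℝ), a ≤ t → |A| ≤ B → |A| / t ^ j ≤ B / a ^ j := by
    intro j t A B hat hAB
    have : 0 ≤ B := (abs_nonneg _).trans hAB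
    gcongr
  match k with
  | 0 => exact red (fun t x => qn f 0 t x) K0 fun t x hat htb => h0 t x (by linarith) htb
  | 1 =>
    refine red (fun t x => -qn f 1 t x / t) (K1 / a ^ 1) fun t x hat htb => ?_
    have ht : 0 < t := by linarith
    have := dv 1 t _ _ hat (h1 t x ht htb)
    rw [abs_div, abs_neg, abs_of_pos ht]
    rw [pow_one] at *
    refine this.trans (le_of_eq (by ring))
  | 2 =>
    refine red (fun t x => -qn f 0 t x / t + qn f 2 t x / t ^ 2) (K0 / a ^ 1 + K2 / a ^ 2)
      fun t x hat htb => ?_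
    have ht : 0 < t := by linarith
    have e1 := dv 1 t _ _ hat (h0 t x ht htb)
    have e2 := dv 2 t _ _ hat (h2 t x ht htb)
    refine (abs_add_le _ _).trans ?_
    rw [abs_div, abs_div, abs_neg, abs_of_pos ht, abs_of_pos (pow_pos ht 2)]
    rw [pow_one] at *
    refine (add_le_add e1 e2).trans (le_of_eq (by ring))
  | (j + 3) =>
    refine red (fun t x => 3 * qn f 1 t x / t ^ 2 - qn f 3 t x / t ^ 3) (3 * K1 / a ^ 2 + K3 / a ^ 3)
      fun t x hat htb => ?_
    have ht : 0 < t := by linarith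
    have e1 := dv 2 t _ _ hat (h1 t x ht htb)
    have e2 := dv 3 t _ _ hat (h3 t x ht htb)
    refine (abs_sub _ _).trans ?_
    rw [abs_div, abs_div, abs_mul, abs_of_pos (pow_pos ht 2), abs_of_pos (pow_pos ht 3),
      abs_of_pos (show (0 : ℝ) < 3 by norm_num), mul_div_assoc]
    refine (add_le_add (mul_le_mul_of_nonneg_left e1 (by norm_num : (0 : ℝ) ≤ 3)) e2).trans (le_of_eq (by ring))

/-- the basic monomials -/
noncomputable def TT (f : ℝ → ℝ) (α : ℝ) (i j k l : ℕ) (t x : ℝ) : ℝ :=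
  PP f 0 t x ^ (α - 4) * (PP f i t x * PP f j t x * PP f k t x * PP f l t x)

lemma TT_bound (f : ℝ → ℝ) (hf : Integrable f) (hf0 : ∀ x, 0 ≤ f x) (hf1 : (∫ x : ℝ, f x) = 1)
    (α : ℝ) (hα : 0 < α) (a b s : ℝ) (ha : 0 < a) (hb : 0 < b) (hbs : b < s) (i j k l : ℕ) :
    ∃ K : ℝ, 0 < K ∧ ∀ t x, a ≤ t → t ≤ b → |TT f α i j k l t x| ≤ K * PP f 0 s x ^ α := by
  obtain ⟨K1, hK1, h1⟩ := PP_bound f hf hf0 hf1 α hα a b s ha hb hbs i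
  obtain ⟨K2, hK2, h2⟩ := PP_bound f hf hf0 hf1 α hα a b s ha hb hbs j
  obtain ⟨K3, hK3, h3⟩ := PP_bound f hf hf0 hf1 α hα a b s ha hb hbs k
  obtain ⟨K4, hK4, h4⟩ := PP_bound f hf hf0 hf1 α hα a b s ha hb hbs l
  have hs : 0 < s := hb.trans hbs
  have hcs := cc_pos hs
  have hca := cc_pos ha
  refine ⟨K1 * K2 * K3 * K4 * (cc a / cc s) ^ α, by positivity, fun t x hat htb => ?_⟩
  have ht : 0 < t := by linarith
  have e1 := h1 t x hat htb
  have e2 := h2 t x hat htb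
  have e3 := h3 t x hat htb
  have e4 := h4 t x hat htb
  have hq := q0_pos f hf hf0 hf1 t x ht
  have hqs := q0_pos f hf hf0 hf1 s x hs
  have hp := P0_pos f hf hf0 hf1 t x ht
  have hps := P0_pos f hf hf0 hf1 s x hs
  have hct := cc_pos ht
  set r := qn f 0 s x / qn f 0 t x with hr
  have hr0 : 0 < r := by positivity
  set p := PP f 0 t x with hpdef
  have hR4 : (r ^ (α / 4)) ^ 4 = r ^ α := by
    rw [← Real.rpow_natCast, ← Real.rpow_mul hr0.le]; congr 1; push_cast; ring
  have hp4 : p ^ (α - 4) * p ^ 4 = p ^ α := by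
    rw [← Real.rpow_natCast p 4, ← Real.rpow_add hp]; congr 1; push_cast; ring
  unfold TT
  rw [abs_mul, abs_mul, abs_mul, abs_mul, abs_of_pos (Real.rpow_pos_of_pos hp _)]
  calc p ^ (α - 4) * (|PP f i t x| * |PP f j t x| * |PP f k t x| * |PP f l t x|)
      ≤ p ^ (α - 4) * ((K1 * r ^ (α / 4) * p) * (K2 * r ^ (α / 4) * p) * (K3 * r ^ (α / 4) * p) *
        (K4 * r ^ (α / 4) * p)) := by gcongr
    _ = K1 * K2 * K3 * K4 * ((r ^ (α / 4)) ^ 4 * (p ^ (α - 4) * p ^ 4)) := by ring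
    _ = K1 * K2 * K3 * K4 * (r * p) ^ α := by rw [hR4, hp4, Real.mul_rpow hr0.le hp.le]
    _ ≤ K1 * K2 * K3 * K4 * (cc a / cc s * PP f 0 s x) ^ α := by
        refine mul_le_mul_of_nonneg_left (Real.rpow_le_rpow (by positivity) ?_ hα.le) (by positivity)
        have : r * p = cc t * qn f 0 s x := by
          rw [hr, hpdef]; simp only [PP]; field_simp
        rw [this]
        have : cc a / cc s * PP f 0 s x = cc a * qn f 0 s x := by
          simp only [PP]; field_simp
        rw [this]
        gcongr
        exact cc_anti ha hat
    _ = _ := by rw [Real.mul_rpow (by positivity) hps.le]; ring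

lemma PP_cont (f : ℝ → ℝ) (hf : Integrable f) (k : ℕ) (t : ℝ) (ht : 0 < t) :
    Continuous (fun x => PP f k t x) := by
  have c : ∀ n, Continuous (fun x => qn f n t x) := fun n =>
    continuous_iff_continuousAt.2 fun x => (qn_dx f hf n t x ht).continuousAt
  have c0 := c 0
  have c1 := c 1
  have c2 := c 2
  have c3 := c 3
  match k with
  | 0 => simp only [PP]; fun_prop
  | 1 => simp only [PP]; fun_prop
  | 2 => simp only [PP]; fun_prop
  | (j + 3) => simp only [PP]; fun_prop

lemma TT_cont (f : ℝ → ℝ) (hf : Integrable f) (hf0 : ∀ x, 0 ≤ f x) (hf1 : (∫ x : ℝ, f x) = 1)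
    (α : ℝ) (i j k l : ℕ) (t : ℝ) (ht : 0 < t) : Continuous (fun x => TT f α i j k l t x) := by
  unfold TT
  have c := fun k => PP_cont f hf k t ht
  exact ((c 0).rpow_const fun x => Or.inl (P0_pos f hf hf0 hf1 t x ht).ne').mul
    ((((c i).mul (c j)).mul (c k)).mul (c l))

lemma P0_integrable (f : ℝ → ℝ) (hf : Integrable f) (t : ℝ) (ht : 0 < t) :
    Integrable (fun x => PP f 0 t x) := by
  have hg : Integrable (fun u : ℝ => Real.exp (-(1 / (2 * t)) * u ^ 2)) :=
    integrable_exp_neg_mul_sq (by positivity)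
  have := (hf.convolution_integrand (ContinuousLinearMap.mul ℝ ℝ) hg).integral_prod_left
  simp only [PP]
  refine (Integrable.congr this (Eventually.of_forall fun x => ?_)).const_mul _
  simp only [qn, ContinuousLinearMap.mul_apply']
  congr 1; ext y
  simp only [pow_zero, one_mul]
  congr 2
  ring

lemma Ps_integrable (f : ℝ → ℝ) (hf : Integrable f) (hf0 : ∀ x, 0 ≤ f x) (hf1 : (∫ x : ℝ, f x) = 1)
    (α : ℝ) (s : ℝ) (hs : 0 < s) (h : renyiFinite f α s) :
    Integrable (fun x => PP f 0 s x ^ α) := by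
  by_cases h1 : 1 ≤ α
  · have hb : ∀ x, qn f 0 s x ≤ 1 := by
      intro x
      rw [← hf1]
      refine integral_mono (qn_int f hf 0 s x hs) hf fun y => ?_
      have := hf0 y
      have e : Real.exp (-(x - y) ^ 2 / (2 * s)) ≤ 1 := by
        rw [Real.exp_le_one_iff]
        exact div_nonpos_of_nonpos_of_nonneg (by nlinarith [sq_nonneg (x - y)]) (by positivity)
      simp only [pow_zero, one_mul]
      nlinarith
    refine Integrable.mono' ((P0_integrable f hf s hs).const_mul (cc s ^ (α - 1)))
      (((PP_cont f hf 0 s hs).rpow_const fun x =>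
        Or.inl (P0_pos f hf hf0 hf1 s x hs).ne').aestronglyMeasurable)
      (Eventually.of_forall fun x => ?_)
    have hp := P0_pos f hf hf0 hf1 s x hs
    have hc := cc_pos hs
    rw [Real.norm_eq_abs, abs_of_pos (Real.rpow_pos_of_pos hp _)]
    have e : PP f 0 s x ^ α = PP f 0 s x ^ (α - 1) * PP f 0 s x := by
      conv_rhs => rw [← Real.rpow_one (PP f 0 s x), ← Real.rpow_mul hp.le, one_mul, ← Real.rpow_add hp]
      congr 1; ring
    rw [e]
    refine mul_le_mul_of_nonneg_right (Real.rpow_le_rpow hp.le ?_ (by linarith)) hp.le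
    change cc s * qn f 0 s x ≤ cc s
    have := hb x
    nlinarith
  · have h2 : α ≠ 1 := by intro h; exact h1 h.ge
    rw [renyiFinite, if_neg h2] at h
    refine h.1.congr (Eventually.of_forall fun x => ?_)
    simp only [heatP_eq]


lemma rpow_shift {p : ℝ} (hp : 0 < p) (α : ℝ) : p ^ (α - 5) = p ^ (α - 4) / p := by
  rw [show α - 5 = (α - 4) - 1 by ring, Real.rpow_sub_one hp.ne']

lemma rpow_s (p : ℝ) (hp : 0 < p) (α : ℝ) (n : ℕ) (m : ℝ) (hm : m + n = 4) :
    p ^ (α - m) = p ^ (α - 4) * p ^ n := by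
  rw [← Real.rpow_natCast p n, ← Real.rpow_add hp]; congr 1; linarith

lemma TT_dx1 (f : ℝ → ℝ) (hf : Integrable f) (hf0 : ∀ x, 0 ≤ f x) (hf1 : (∫ x : ℝ, f x) = 1)
    (α t x : ℝ) (ht : 0 < t) :
    HasDerivAt (fun x => TT f α 0 0 0 1 t x)
      ((α - 1) * TT f α 0 0 1 1 t x + TT f α 0 0 0 2 t x) x := by
  have hp := P0_pos f hf hf0 hf1 t x ht
  have d0 := PP_dx f hf 0 (by norm_num) t x ht
  have d1 := PP_dx f hf 1 (by norm_num) t x ht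
  have d := (d0.rpow_const (p := α - 4) (Or.inl hp.ne')).fun_mul
    (((d0.fun_mul d0).fun_mul d0).fun_mul d1)
  refine d.congr_deriv ?_
  simp only [TT]
  rw [show α - 4 - 1 = α - 5 by ring, rpow_shift hp]
  norm_num
  field_simp
  ring

lemma TT_dx2 (f : ℝ → ℝ) (hf : Integrable f) (hf0 : ∀ x, 0 ≤ f x) (hf1 : (∫ x : ℝ, f x) = 1)
    (α t x : ℝ) (ht : 0 < t) :
    HasDerivAt (fun x => TT f α 0 0 1 2 t x)
      ((α - 2) * TT f α 0 1 1 2 t x + TT f α 0 0 2 2 t x + TT f α 0 0 1 3 t x) x := by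
  have hp := P0_pos f hf hf0 hf1 t x ht
  have d0 := PP_dx f hf 0 (by norm_num) t x ht
  have d1 := PP_dx f hf 1 (by norm_num) t x ht
  have d2 := PP_dx f hf 2 (by norm_num) t x ht
  have d := (d0.rpow_const (p := α - 4) (Or.inl hp.ne')).fun_mul
    (((d0.fun_mul d0).fun_mul d1).fun_mul d2)
  refine d.congr_deriv ?_
  simp only [TT]
  rw [show α - 4 - 1 = α - 5 by ring, rpow_shift hp]
  norm_num
  field_simp
  ring

lemma TT_dx3 (f : ℝ → ℝ) (hf : Integrable f) (hf0 : ∀ x, 0 ≤ f x) (hf1 : (∫ x : ℝ, f x) = 1)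
    (α t x : ℝ) (ht : 0 < t) :
    HasDerivAt (fun x => TT f α 0 1 1 1 t x)
      ((α - 3) * TT f α 1 1 1 1 t x + 3 * TT f α 0 1 1 2 t x) x := by
  have hp := P0_pos f hf hf0 hf1 t x ht
  have d0 := PP_dx f hf 0 (by norm_num) t x ht
  have d1 := PP_dx f hf 1 (by norm_num) t x ht
  have d := (d0.rpow_const (p := α - 4) (Or.inl hp.ne')).fun_mul
    (((d0.fun_mul d1).fun_mul d1).fun_mul d1)
  refine d.congr_deriv ?_
  simp only [TT]
  rw [show α - 4 - 1 = α - 5 by ring, rpow_shift hp]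
  norm_num
  field_simp
  ring

lemma TT_dt1 (f : ℝ → ℝ) (hf : Integrable f) (hf0 : ∀ x, 0 ≤ f x) (hf1 : (∫ x : ℝ, f x) = 1)
    (α t x : ℝ) (ht : 0 < t) :
    HasDerivAt (fun t => TT f α 0 0 1 1 t x)
      ((α - 2) / 2 * TT f α 0 1 1 2 t x + TT f α 0 0 1 3 t x) t := by
  have hp := P0_pos f hf hf0 hf1 t x ht
  have d0 := PP_dt f hf 0 (by norm_num) t x ht
  have d1 := PP_dt f hf 1 (by norm_num) t x ht
  have d := (d0.rpow_const (p := α - 4) (Or.inl hp.ne')).fun_mul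
    (((d0.fun_mul d0).fun_mul d1).fun_mul d1)
  refine d.congr_deriv ?_
  simp only [TT]
  rw [show α - 4 - 1 = α - 5 by ring, rpow_shift hp]
  norm_num
  field_simp
  ring

lemma TT_dt2 (f : ℝ → ℝ) (hf : Integrable f) (hf0 : ∀ x, 0 ≤ f x) (hf1 : (∫ x : ℝ, f x) = 1)
    (α t x : ℝ) (ht : 0 < t) :
    HasDerivAt (fun t => TT f α 0 0 0 0 t x) (α / 2 * TT f α 0 0 0 2 t x) t := by
  have hp := P0_pos f hf hf0 hf1 t x ht
  have d0 := PP_dt f hf 0 (by norm_num) t x ht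
  have d := (d0.rpow_const (p := α - 4) (Or.inl hp.ne')).fun_mul
    (((d0.fun_mul d0).fun_mul d0).fun_mul d0)
  refine d.congr_deriv ?_
  simp only [TT]
  rw [show α - 4 - 1 = α - 5 by ring, rpow_shift hp]
  norm_num
  field_simp
  ring

/-- Time derivatives of the integrals of p^(α-2)·p₁² and of p^α along the heat flow. -/
theorem deriv_of_integrals_along_heat_flow
    (f : ℝ → ℝ) (hfm : Measurable f) (hf0 : ∀ x, 0 ≤ f x)
    (hf1 : (∫ x : ℝ, f x) = 1)
    (α : ℝ) (hα : 0 < α)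
    (t : ℝ) (ht : 0 < t) (htα : ltTalpha f α t) :
    HasDerivAt (fun s => ∫ x : ℝ, heatP f s x ^ (α - 2) * (pk f 1 s x) ^ 2)
      ((α - 2) * (α - 3) / 6 * (∫ x : ℝ, heatP f t x ^ (α - 4) * (pk f 1 t x) ^ 4)
        - (∫ x : ℝ, heatP f t x ^ (α - 2) * (pk f 2 t x) ^ 2)) t
    ∧ HasDerivAt (fun s => ∫ x : ℝ, heatP f s x ^ α)
      (-(α * (α - 1) / 2) * (∫ x : ℝ, heatP f t x ^ (α - 2) * (pk f 1 t x) ^ 2)) t := by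
  have hf : Integrable f := by
    by_contra h
    rw [integral_undef h] at hf1
    norm_num at hf1
  obtain ⟨s, hts, hs, hfin⟩ := htα
  have hI := Ps_integrable f hf hf0 hf1 α s hs hfin
  set a := t / 2 with ha
  set b := (t + s) / 2 with hb
  have ha0 : 0 < a := by linarith
  have hb0 : 0 < b := by linarith
  have hbs : b < s := by linarith
  have hat : a < t := by linarith
  have htb : t < b := by linarith
  have bnd := TT_bound f hf hf0 hf1 α hα a b s ha0 hb0 hbs
  have int : ∀ i j k l, Integrable (fun x => TT f α i j k l t x) := by
    intro i j k l
    obtain ⟨K, hK, h⟩ := bnd i j k l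
    exact (hI.const_mul K).mono' (TT_cont f hf hf0 hf1 α i j k l t ht).aestronglyMeasurable
      (Eventually.of_forall fun x => h t x hat.le htb.le)
  -- integrations by parts
  have I1 : (α - 1) * (∫ x, TT f α 0 0 1 1 t x) + ∫ x, TT f α 0 0 0 2 t x = 0 := by
    rw [← integral_const_mul, ← integral_add ((int _ _ _ _).const_mul _) (int _ _ _ _)]
    exact integral_eq_zero_of_hasDerivAt_of_integrable
      (fun x => TT_dx1 f hf hf0 hf1 α t x ht) (((int _ _ _ _).const_mul _).add (int _ _ _ _))
      (int _ _ _ _)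
  have I2 : (α - 2) * (∫ x, TT f α 0 1 1 2 t x) + (∫ x, TT f α 0 0 2 2 t x)
      + ∫ x, TT f α 0 0 1 3 t x = 0 := by
    rw [← integral_const_mul, ← integral_add ((int _ _ _ _).const_mul _) (int _ _ _ _),
      ← integral_add (f := fun x => (α - 2) * TT f α 0 1 1 2 t x + TT f α 0 0 2 2 t x)
        (((int _ _ _ _).const_mul _).add (int _ _ _ _)) (int _ _ _ _)]
    exact integral_eq_zero_of_hasDerivAt_of_integrable
      (fun x => TT_dx2 f hf hf0 hf1 α t x ht)
      ((((int _ _ _ _).const_mul _).add (int _ _ _ _)).add (int _ _ _ _))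
      (int _ _ _ _)
  have I3 : (α - 3) * (∫ x, TT f α 1 1 1 1 t x) + 3 * ∫ x, TT f α 0 1 1 2 t x = 0 := by
    rw [← integral_const_mul, ← integral_const_mul,
      ← integral_add ((int _ _ _ _).const_mul _) ((int _ _ _ _).const_mul _)]
    exact integral_eq_zero_of_hasDerivAt_of_integrable
      (fun x => TT_dx3 f hf hf0 hf1 α t x ht)
      (((int _ _ _ _).const_mul _).add ((int _ _ _ _).const_mul _))
      (int _ _ _ _)
  -- differentiation under the integral
  have D1 : HasDerivAt (fun τ => ∫ x, TT f α 0 0 1 1 τ x)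
      ((α - 2) / 2 * (∫ x, TT f α 0 1 1 2 t x) + ∫ x, TT f α 0 0 1 3 t x) t := by
    obtain ⟨K1, hK1, h1⟩ := bnd 0 1 1 2
    obtain ⟨K2, hK2, h2⟩ := bnd 0 0 1 3
    have key := hasDerivAt_integral_of_dominated_loc_of_deriv_le (μ := volume) (x₀ := t)
      (s := Set.Ioo a b)
      (F := fun τ x => TT f α 0 0 1 1 τ x)
      (F' := fun τ x => (α - 2) / 2 * TT f α 0 1 1 2 τ x + TT f α 0 0 1 3 τ x)
      (bound := fun x => (|(α - 2) / 2| * K1 + K2) * PP f 0 s x ^ α)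
      (Ioo_mem_nhds hat htb)
      (by
        filter_upwards [Ioi_mem_nhds ht] with τ hτ
        exact (TT_cont f hf hf0 hf1 α _ _ _ _ τ hτ).aestronglyMeasurable)
      (int _ _ _ _)
      (((int _ _ _ _).const_mul _).add (int _ _ _ _)).aestronglyMeasurable
      (Eventually.of_forall fun x τ hτ => by
        rw [Real.norm_eq_abs]
        refine (abs_add_le _ _).trans ?_
        rw [abs_mul, add_mul, mul_assoc]
        have e1 := h1 τ x hτ.1.le hτ.2.le
        have e2 := h2 τ x hτ.1.le hτ.2.le
        gcongr)
      (hI.const_mul _)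
      (Eventually.of_forall fun x τ hτ => TT_dt1 f hf hf0 hf1 α τ x (ha0.trans hτ.1))
    have := key.2
    rwa [integral_add ((int _ _ _ _).const_mul _) (int _ _ _ _), integral_const_mul] at this
  have D2 : HasDerivAt (fun τ => ∫ x, TT f α 0 0 0 0 τ x)
      (α / 2 * (∫ x, TT f α 0 0 0 2 t x)) t := by
    obtain ⟨K1, hK1, h1⟩ := bnd 0 0 0 2
    have key := hasDerivAt_integral_of_dominated_loc_of_deriv_le (μ := volume) (x₀ := t)
      (s := Set.Ioo a b)
      (F := fun τ x => TT f α 0 0 0 0 τ x)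
      (F' := fun τ x => α / 2 * TT f α 0 0 0 2 τ x)
      (bound := fun x => |α / 2| * (K1 * PP f 0 s x ^ α))
      (Ioo_mem_nhds hat htb)
      (by
        filter_upwards [Ioi_mem_nhds ht] with τ hτ
        exact (TT_cont f hf hf0 hf1 α _ _ _ _ τ hτ).aestronglyMeasurable)
      (int _ _ _ _)
      ((int _ _ _ _).const_mul _).aestronglyMeasurable
      (Eventually.of_forall fun x τ hτ => by
        rw [Real.norm_eq_abs, abs_mul]
        have e1 := h1 τ x hτ.1.le hτ.2.le
        gcongr)
      ((hI.const_mul _).const_mul _)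
      (Eventually.of_forall fun x τ hτ => TT_dt2 f hf hf0 hf1 α τ x (ha0.trans hτ.1))
    have := key.2
    rwa [integral_const_mul] at this
  -- identification of the integrands
  have E0 : ∀ τ, 0 < τ → (∫ x : ℝ, heatP f τ x ^ α) = ∫ x, TT f α 0 0 0 0 τ x := by
    intro τ hτ
    congr 1; ext x
    have hp := P0_pos f hf hf0 hf1 τ x hτ
    have := rpow_s _ hp α 4 0 (by norm_num)
    rw [sub_zero] at this
    rw [heatP_eq, this, TT]; ring
  have E1 : ∀ τ, 0 < τ → (∫ x : ℝ, heatP f τ x ^ (α - 2) * (pk f 1 τ x) ^ 2)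
      = ∫ x, TT f α 0 0 1 1 τ x := by
    intro τ hτ
    congr 1; ext x
    have hp := P0_pos f hf hf0 hf1 τ x hτ
    rw [heatP_eq, pk1_eq f hf τ x hτ, rpow_s _ hp α 2 2 (by norm_num), TT]; ring
  have E2 : (∫ x : ℝ, heatP f t x ^ (α - 2) * (pk f 2 t x) ^ 2)
      = ∫ x, TT f α 0 0 2 2 t x := by
    congr 1; ext x
    have hp := P0_pos f hf hf0 hf1 t x ht
    rw [heatP_eq, pk2_eq f hf t x ht, rpow_s _ hp α 2 2 (by norm_num), TT]; ring
  have E4 : (∫ x : ℝ, heatP f t x ^ (α - 4) * (pk f 1 t x) ^ 4)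
      = ∫ x, TT f α 1 1 1 1 t x := by
    congr 1; ext x
    rw [heatP_eq, pk1_eq f hf t x ht, TT]; ring
  rw [E2, E4, E1 t ht]
  constructor
  · refine HasDerivAt.congr_of_eventuallyEq (D1.congr_deriv ?_) ?_
    · linear_combination I2 - (α - 2) / 6 * I3
    · filter_upwards [Ioi_mem_nhds ht] with τ hτ
      exact E1 τ hτ
  · refine HasDerivAt.congr_of_eventuallyEq (D2.congr_deriv ?_) ?_
    · linear_combination α / 2 * I1
    · filter_upwards [Ioi_mem_nhds ht] with τ hτ
      exact E0 τ hτ
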